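/- For each of the Banach spaces Ω ∈ { c_0, c, l^α for 1 ≤ α < ∞ } of complex sequences indexed by the nonnegative integers, the spectrum of the transition operator S acting on Ω is equal to the fibered filled Julia set E. -/

import Mathlib

open Filter Finset
open scoped ENNReal Topology ZeroAtInfty

noncomputable section

namespace AMFC

/-- `q d j = d 0 * d 1 * ... * d j`. -/
def q (d : ℕ → ℕ) (j : ℕ) : ℕ := ∏ i ∈ Finset.range (j + 1), d i

/-- For `j ≥ 1`, `digit d n j = ⌊n / q_{j-1}⌋ mod d_j` is the `j`-th digit of `n`
in the Cantor system of numeration. -/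
def digit (d : ℕ → ℕ) (n j : ℕ) : ℕ := (n / q d (j - 1)) % d j

/-- The counter `ζ_n = min { j ≥ 1 : a_j(n) ≠ d_j - 1 }`. -/
def zeta (d : ℕ → ℕ) (n : ℕ) : ℕ := sInf {j | 1 ≤ j ∧ digit d n j ≠ d j - 1}

open scoped Classical in
/-- The transition probabilities of the stochastic adding machine. -/
def s (d : ℕ → ℕ) (p : ℕ → ℝ) (n m : ℕ) : ℝ :=
  if m = n + 1 then ∏ j ∈ Finset.Icc 1 (zeta d n), p j
  else if m = n then 1 - p 1
  else if h : ∃ r, 1 ≤ r ∧ r + 1 ≤ zeta d n ∧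
      n = m + ∑ j ∈ Finset.Icc 1 r, (d j - 1) * q d (j - 1)
    then (1 - p (h.choose + 1)) * ∏ j ∈ Finset.Icc 1 h.choose, p j
  else 0

/-- `f j (z) = ((z - (1 - p j)) / p j) ^ (d j)`. -/
def f (d : ℕ → ℕ) (p : ℕ → ℝ) (j : ℕ) (z : ℂ) : ℂ :=
  ((z - (1 - (p j : ℂ))) / (p j : ℂ)) ^ d j

/-- `ftil j = f j ∘ ... ∘ f 1`, with `ftil 0 = id`. -/
def ftil (d : ℕ → ℕ) (p : ℕ → ℝ) : ℕ → ℂ → ℂ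
  | 0 => id
  | j + 1 => f d p (j + 1) ∘ ftil d p j

/-- The fibered filled Julia set `E = {z : limsup_j |ftil j z| < ∞}`. -/
def E (d : ℕ → ℕ) (p : ℕ → ℝ) : Set ℂ :=
  {z | Filter.limsup (fun j => (‖ftil d p j z‖₊ : ℝ≥0∞)) Filter.atTop < ⊤}

/-- `ι_λ(r) = (ftil (r-1) λ - (1 - p r)) / p r` for `r ≥ 1`. -/
def iota (d : ℕ → ℕ) (p : ℕ → ℝ) (lam : ℂ) (r : ℕ) : ℂ :=
  (ftil d p (r - 1) lam - (1 - (p r : ℂ))) / (p r : ℂ)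

/-- `v_λ(n) = ∏_{r ≥ 1} ι_λ(r) ^ a_r(n)`, a finite product. -/
def vlam (d : ℕ → ℕ) (p : ℕ → ℝ) (lam : ℂ) (n : ℕ) : ℂ :=
  ∏ᶠ r : ℕ, iota d p lam (r + 1) ^ digit d n (r + 1)

/-- The point spectrum of a continuous linear operator. -/
def pointSpectrum {M : Type*} [NormedAddCommGroup M] [NormedSpace ℂ M]
    (T : M →L[ℂ] M) : Set ℂ :=
  {lam | ∃ v, v ≠ 0 ∧ T v = lam • v}

/-- The residual spectrum: `T - λI` is injective but its range is not dense. -/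
def residualSpectrum {M : Type*} [NormedAddCommGroup M] [NormedSpace ℂ M]
    (T : M →L[ℂ] M) : Set ℂ :=
  {lam | Function.Injective ⇑(T - lam • (1 : M →L[ℂ] M)) ∧
    ¬ DenseRange ⇑(T - lam • (1 : M →L[ℂ] M))}

/-- The continuous spectrum: `T - λI` is injective with dense range, but not surjective. -/
def continuousSpectrum {M : Type*} [NormedAddCommGroup M] [NormedSpace ℂ M]
    (T : M →L[ℂ] M) : Set ℂ :=
  {lam | Function.Injective ⇑(T - lam • (1 : M →L[ℂ] M)) ∧
    DenseRange ⇑(T - lam • (1 : M →L[ℂ] M)) ∧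
    Set.range ⇑(T - lam • (1 : M →L[ℂ] M)) ≠ Set.univ}

/-- The standing hypotheses. -/
structure Mach (d : ℕ → ℕ) (p : ℕ → ℝ) : Prop where
  d0 : d 0 = 1
  hd : ∀ j, 1 ≤ j → 2 ≤ d j
  hp : ∀ j, 1 ≤ j → p j ∈ Set.Ioc (0 : ℝ) 1

/-- shifted base -/
def shd (d : ℕ → ℕ) (j : ℕ) : ℕ := if j = 0 then 1 else d (j + 1)

/-- shifted probabilities -/
def shp (p : ℕ → ℝ) (j : ℕ) : ℝ := p (j + 1)

theorem Mach.shift {d : ℕ → ℕ} {p : ℕ → ℝ} (h : Mach d p) : Mach (shd d) (shp p) where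
  d0 := by simp [shd]
  hd := fun j hj => by
    have : j ≠ 0 := by omega
    simp only [shd, this, if_false]
    exact h.hd _ (by omega)
  hp := fun j hj => h.hp _ (by omega)

theorem q_succ (d : ℕ → ℕ) (j : ℕ) : q d (j + 1) = q d j * d (j + 1) := by
  simp [q, Finset.prod_range_succ]

theorem q_zero {d : ℕ → ℕ} (h0 : d 0 = 1) : q d 0 = 1 := by simp [q, h0]

theorem q_shift {d : ℕ → ℕ} (h0 : d 0 = 1) (j : ℕ) : q d (j + 1) = d 1 * q (shd d) j := by
  induction j with
  | zero => rw [q_succ, q_zero h0, q_zero (by simp [shd])]; ring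
  | succ j ih => rw [q_succ, ih, q_succ (shd d)]; simp [shd, mul_assoc]

theorem Mach.lt_q {d : ℕ → ℕ} {p : ℕ → ℝ} (h : Mach d p) (j : ℕ) : j < q d j := by
  induction j with
  | zero => rw [q_zero h.d0]; omega
  | succ j ih =>
    rw [q_succ]
    have := h.hd (j + 1) (by omega)
    nlinarith

theorem Mach.q_strictMono {d : ℕ → ℕ} {p : ℕ → ℝ} (h : Mach d p) : StrictMono (q d) := by
  refine strictMono_nat_of_lt_succ fun j => ?_
  rw [q_succ]
  have := h.hd (j + 1) (by omega)
  have := h.lt_q j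
  nlinarith

theorem Mach.sum_q {d : ℕ → ℕ} {p : ℕ → ℝ} (h : Mach d p) (r : ℕ) :
    ∑ j ∈ Finset.Icc 1 r, (d j - 1) * q d (j - 1) + 1 = q d r := by
  induction r with
  | zero => simp [q_zero h.d0]
  | succ r ih =>
    rw [Finset.sum_Icc_succ_top (by omega), q_succ, ← ih]
    have := h.hd (r + 1) (by omega)
    obtain ⟨e, he⟩ : ∃ e, d (r + 1) = e + 1 := ⟨d (r + 1) - 1, by omega⟩
    simp only [he, Nat.add_sub_cancel, ih]
    rw [← ih]
    ring

theorem Mach.zeta_mem {d : ℕ → ℕ} {p : ℕ → ℝ} (h : Mach d p) (n : ℕ) :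
    zeta d n ∈ {j | 1 ≤ j ∧ digit d n j ≠ d j - 1} := by
  apply Nat.sInf_mem
  refine ⟨n + 1, by omega, ?_⟩
  have h1 := h.hd (n + 1) (by omega)
  have : digit d n (n + 1) = 0 := by
    simp only [digit, Nat.add_sub_cancel]
    rw [Nat.div_eq_of_lt (h.lt_q n)]; simp
  omega

theorem digit_shift {d : ℕ → ℕ} (h0 : d 0 = 1) (n j : ℕ) (hj : 1 ≤ j) :
    digit d n (j + 1) = digit (shd d) (n / d 1) j := by
  obtain ⟨i, rfl⟩ : ∃ i, j = i + 1 := ⟨j - 1, by omega⟩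
  simp only [digit, Nat.add_sub_cancel]
  rw [q_shift h0, Nat.div_div_eq_div_mul]
  simp [shd]

theorem digit_one {d : ℕ → ℕ} (h0 : d 0 = 1) (n : ℕ) : digit d n 1 = n % d 1 := by
  simp [digit, q_zero h0]

theorem Mach.zeta_one {d : ℕ → ℕ} {p : ℕ → ℝ} (h : Mach d p) (n : ℕ)
    (hn : n % d 1 + 1 < d 1) : zeta d n = 1 := by
  apply le_antisymm
  · apply Nat.sInf_le
    refine ⟨le_rfl, ?_⟩
    rw [digit_one h.d0]; omega
  · exact (h.zeta_mem n).1

theorem Mach.zeta_shift {d : ℕ → ℕ} {p : ℕ → ℝ} (h : Mach d p) (n : ℕ)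
    (hn : n % d 1 + 1 = d 1) : zeta d n = zeta (shd d) (n / d 1) + 1 := by
  have hz := h.zeta_mem n
  have hz' := h.shift.zeta_mem (n / d 1)
  apply le_antisymm
  · apply Nat.sInf_le
    refine ⟨by omega, ?_⟩
    rw [digit_shift h.d0 _ _ hz'.1]
    have := hz'.2
    have h0 : zeta (shd d) (n / d 1) ≠ 0 := by have := hz'.1; omega
    simpa [shd, h0] using this
  · obtain ⟨hz1, hz2⟩ := hz
    have hne : zeta d n ≠ 1 := by
      intro h1
      rw [h1, digit_one h.d0] at hz2
      omega
    obtain ⟨i, hi⟩ : ∃ i, zeta d n = i + 1 := ⟨zeta d n - 1, by omega⟩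
    rw [hi] at hz2 ⊢
    have hi1 : 1 ≤ i := by omega
    have : zeta (shd d) (n / d 1) ≤ i := by
      apply Nat.sInf_le
      refine ⟨hi1, ?_⟩
      rw [← digit_shift h.d0 _ _ hi1]
      have h0 : i ≠ 0 := by omega
      simpa [shd, h0] using hz2
    omega

theorem prod_shift (p : ℕ → ℝ) (r : ℕ) :
    ∏ j ∈ Finset.Icc 1 (r + 1), p j = p 1 * ∏ j ∈ Finset.Icc 1 r, shp p j := by
  induction r with
  | zero => simp
  | succ r ih =>
    rw [Finset.prod_Icc_succ_top (by omega), ih, Finset.prod_Icc_succ_top (by omega)]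
    simp [shp, mul_assoc]

theorem Mach.s_jump {d : ℕ → ℕ} {p : ℕ → ℝ} (h : Mach d p) {n m r : ℕ} (h1 : 1 ≤ r)
    (h2 : r + 1 ≤ zeta d n) (h3 : n + 1 = m + q d r) :
    s d p n m = (1 - p (r + 1)) * ∏ j ∈ Finset.Icc 1 r, p j := by
  have hq := h.lt_q r
  have hex : ∃ r, 1 ≤ r ∧ r + 1 ≤ zeta d n ∧
      n = m + ∑ j ∈ Finset.Icc 1 r, (d j - 1) * q d (j - 1) :=
    ⟨r, h1, h2, by have := h.sum_q r; omega⟩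
  have hc : hex.choose = r := by
    have h4 := hex.choose_spec.2.2
    have := h.sum_q hex.choose
    apply h.q_strictMono.injective
    omega
  unfold s
  rw [if_neg (by omega), if_neg (by omega), dif_pos hex, hc]

theorem Mach.s_zero {d : ℕ → ℕ} {p : ℕ → ℝ} (h : Mach d p) {n m : ℕ} (h1 : m ≠ n + 1) (h2 : m ≠ n)
    (h3 : ∀ r, 1 ≤ r → r + 1 ≤ zeta d n → n + 1 ≠ m + q d r) : s d p n m = 0 := by
  unfold s
  rw [if_neg h1, if_neg h2, dif_neg]
  rintro ⟨r, hr1, hr2, hr3⟩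
  have := h.sum_q r
  exact h3 r hr1 hr2 (by omega)

theorem s_succ (d : ℕ → ℕ) (p : ℕ → ℝ) (n : ℕ) :
    s d p n (n + 1) = ∏ j ∈ Finset.Icc 1 (zeta d n), p j := by
  simp [s]

theorem s_self (d : ℕ → ℕ) (p : ℕ → ℝ) (n : ℕ) : s d p n n = 1 - p 1 := by
  simp [s]

theorem Mach.s_rec1 {d : ℕ → ℕ} {p : ℕ → ℝ} (h : Mach d p) (n k : ℕ)
    (hn : n % d 1 + 1 < d 1) :
    s d p n k = (1 - p 1) * (if k = n then 1 else 0) + p 1 * (if k = n + 1 then 1 else 0) := by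
  have hz := h.zeta_one n hn
  by_cases h1 : k = n + 1
  · subst h1; simp [s_succ, hz]
  by_cases h2 : k = n
  · subst h2; simp [s_self]
  rw [h.s_zero h1 h2 (by intro r; omega)]
  simp [h1, h2]

theorem Mach.s_rec2 {d : ℕ → ℕ} {p : ℕ → ℝ} (h : Mach d p) (m k : ℕ) :
    s d p (d 1 * m + (d 1 - 1)) k = (1 - p 1) * (if k = d 1 * m + (d 1 - 1) then 1 else 0)
      + p 1 * (if d 1 ∣ k then s (shd d) (shp p) m (k / d 1) else 0) := by
  have hd1 := h.hd 1 le_rfl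
  obtain ⟨n, hn⟩ : ∃ n, n = d 1 * m + (d 1 - 1) := ⟨_, rfl⟩
  have hmod : n % d 1 + 1 = d 1 := by
    rw [hn, Nat.mul_add_mod, Nat.mod_eq_of_lt (by omega)]; omega
  have hdiv : n / d 1 = m := by
    rw [hn, Nat.mul_add_div (by omega), Nat.div_eq_of_lt (by omega)]; omega
  have hz := h.zeta_shift n hmod
  rw [hdiv] at hz
  rw [← hn]
  have hn1 : n + 1 = d 1 * (m + 1) := by rw [hn, mul_add]; omega
  have hnd : ¬ d 1 ∣ n := by
    intro hh; rw [Nat.dvd_iff_mod_eq_zero] at hh; omega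
  by_cases h2 : k = n
  · subst h2; simp [s_self, hnd]
  by_cases hk : d 1 ∣ k
  · obtain ⟨m', rfl⟩ := hk
    rw [Nat.mul_div_cancel_left _ (by omega : 0 < d 1)]
    simp only [h2, if_false, dvd_mul_right, if_true, mul_zero, zero_add]
    by_cases h1 : m' = m + 1
    · subst h1
      rw [← hn1, s_succ, s_succ, hz, prod_shift]
    have h1' : d 1 * m' ≠ n + 1 := by
      rw [hn1]; intro hh; exact h1 (Nat.eq_of_mul_eq_mul_left (by omega) hh)
    have hz1 := (h.shift.zeta_mem m).1
    by_cases h3 : m' = m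
    · subst h3
      rw [s_self, h.s_jump (r := 1) le_rfl (by omega)]
      · simp [shp, mul_comm]
      · rw [hn1, q_succ, q_zero h.d0]; ring
    by_cases h4 : ∃ r, 1 ≤ r ∧ r + 1 ≤ zeta (shd d) m ∧ m + 1 = m' + q (shd d) r
    · obtain ⟨r, hr1, hr2, hr3⟩ := h4
      rw [h.shift.s_jump hr1 hr2 hr3, h.s_jump (r := r + 1) (by omega) (by omega), prod_shift]
      · simp [shp]; ring
      · rw [hn1, q_shift h.d0, hr3]; ring
    · push Not at h4
      rw [h.shift.s_zero h1 h3 h4, mul_zero]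
      apply h.s_zero h1' h2
      intro r hr1 hr2 hr3
      obtain ⟨i, rfl⟩ : ∃ i, r = i + 1 := ⟨r - 1, by omega⟩
      rw [hn1, q_shift h.d0, ← mul_add] at hr3
      have hr4 := Nat.eq_of_mul_eq_mul_left (by omega) hr3
      by_cases hi : i = 0
      · subst hi
        rw [q_zero h.shift.d0] at hr4; omega
      · exact h4 i (by omega) (by omega) hr4
  · simp only [h2, hk, if_false, mul_zero, add_zero]
    apply h.s_zero _ h2
    · intro r hr1 hr2 hr3
      obtain ⟨i, rfl⟩ : ∃ i, r = i + 1 := ⟨r - 1, by omega⟩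
      rw [hn1, q_shift h.d0] at hr3
      apply hk
      exact (Nat.dvd_add_left (dvd_mul_right _ _)).1 (hr3 ▸ dvd_mul_right _ _)
    · rintro rfl
      exact hk (hn1 ▸ dvd_mul_right _ _)

theorem Mach.cases {d : ℕ → ℕ} {p : ℕ → ℝ} (h : Mach d p) (n : ℕ) :
    n % d 1 + 1 < d 1 ∨ ∃ m, m < n ∧ n = d 1 * m + (d 1 - 1) := by
  have hd1 := h.hd 1 le_rfl
  have h1 := Nat.mod_lt n (by omega : 0 < d 1)
  have h2 := Nat.div_add_mod n (d 1)
  by_cases hc : n % d 1 + 1 < d 1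
  · exact Or.inl hc
  · right
    refine ⟨n / d 1, ?_, by omega⟩
    apply Nat.div_lt_self _ (by omega)
    by_contra h0
    have : n = 0 := by omega
    subst this
    simp at hc; omega

theorem Mach.s_nonneg {d : ℕ → ℕ} {p : ℕ → ℝ} (h : Mach d p) (n k : ℕ) : 0 ≤ s d p n k := by
  induction n using Nat.strong_induction_on generalizing d p k with
  | _ n ih =>
    obtain ⟨h1, h2⟩ := h.hp 1 le_rfl
    have h3 : 0 ≤ 1 - p 1 := by linarith
    rcases h.cases n with hc | ⟨m, hm, hc⟩
    · rw [h.s_rec1 n k hc]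
      positivity
    · rw [hc, h.s_rec2]
      have := ih m hm h.shift (k / d 1)
      positivity

theorem Mach.s_far {d : ℕ → ℕ} {p : ℕ → ℝ} (h : Mach d p) {n k : ℕ} (hk : n + 1 < k) :
    s d p n k = 0 :=
  h.s_zero (by omega) (by omega) (by intros; omega)

/-- The operator on sequences. -/
def Sop (d : ℕ → ℕ) (p : ℕ → ℝ) (w : ℕ → ℂ) (n : ℕ) : ℂ := ∑' m : ℕ, (s d p n m : ℂ) * w m

theorem Mach.Sop_eq {d : ℕ → ℕ} {p : ℕ → ℝ} (h : Mach d p) (w : ℕ → ℂ) (n N : ℕ) (hN : n + 2 ≤ N) :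
    Sop d p w n = ∑ m ∈ range N, (s d p n m : ℂ) * w m := by
  unfold Sop
  apply tsum_eq_sum
  intro m hm
  rw [h.s_far (by simp at hm; omega)]; simp

theorem Mach.Sop_summable {d : ℕ → ℕ} {p : ℕ → ℝ} (h : Mach d p) (w : ℕ → ℂ) (n : ℕ) :
    Summable fun m : ℕ => (s d p n m : ℂ) * w m := by
  apply summable_of_ne_finset_zero (s := range (n + 2))
  intro m hm
  rw [h.s_far (by simp at hm; omega)]; simp

theorem Mach.Sop_add {d : ℕ → ℕ} {p : ℕ → ℝ} (h : Mach d p) (w v : ℕ → ℂ) (n : ℕ) :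
    Sop d p (w + v) n = Sop d p w n + Sop d p v n := by
  simp only [h.Sop_eq _ n _ le_rfl, Pi.add_apply, mul_add, Finset.sum_add_distrib]

theorem Mach.Sop_smul {d : ℕ → ℕ} {p : ℕ → ℝ} (h : Mach d p) (c : ℂ) (w : ℕ → ℂ) (n : ℕ) :
    Sop d p (c • w) n = c * Sop d p w n := by
  simp only [h.Sop_eq _ n _ le_rfl, Pi.smul_apply, smul_eq_mul, Finset.mul_sum]
  exact Finset.sum_congr rfl fun _ _ => by ring

theorem Mach.Sop_sub {d : ℕ → ℕ} {p : ℕ → ℝ} (h : Mach d p) (w v : ℕ → ℂ) (n : ℕ) :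
    Sop d p (w - v) n = Sop d p w n - Sop d p v n := by
  simp only [h.Sop_eq _ n _ le_rfl, Pi.sub_apply, mul_sub, Finset.sum_sub_distrib]

theorem Mach.Sop_rec1 {d : ℕ → ℕ} {p : ℕ → ℝ} (h : Mach d p) (w : ℕ → ℂ) (n : ℕ)
    (hn : n % d 1 + 1 < d 1) :
    Sop d p w n = (1 - p 1) * w n + p 1 * w (n + 1) := by
  rw [h.Sop_eq w n _ le_rfl]
  have e : ∀ k, (s d p n k : ℂ) * w k = (if k = n then (1 - p 1) * w n else 0) +
      (if k = n + 1 then p 1 * w (n + 1) else 0) := by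
    intro k
    rw [h.s_rec1 n k hn]
    by_cases h1 : k = n
    · subst h1; simp
    · by_cases h2 : k = n + 1
      · subst h2; simp
      · simp [h1, h2]
  rw [Finset.sum_congr rfl fun k _ => e k, Finset.sum_add_distrib]
  simp

theorem Mach.Sop_rec2 {d : ℕ → ℕ} {p : ℕ → ℝ} (h : Mach d p) (w : ℕ → ℂ) (m : ℕ) :
    Sop d p w (d 1 * m + (d 1 - 1)) = (1 - p 1) * w (d 1 * m + (d 1 - 1))
      + p 1 * Sop (shd d) (shp p) (fun j => w (d 1 * j)) m := by
  have hd1 := h.hd 1 le_rfl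
  have e1 : Sop (shd d) (shp p) (fun j => w (d 1 * j)) m =
      ∑' k, ((if d 1 ∣ k then (s (shd d) (shp p) m (k / d 1) : ℂ) else 0) * w k) := by
    have hinj : Function.Injective (fun j : ℕ => d 1 * j) :=
      fun a b hab => Nat.eq_of_mul_eq_mul_left (by omega) hab
    rw [← hinj.tsum_eq]
    · unfold Sop
      refine tsum_congr fun j => ?_
      simp [Nat.mul_div_cancel_left _ (by omega : 0 < d 1)]
    · intro k hk
      by_contra hc
      apply hk
      have : ¬ d 1 ∣ k := fun ⟨j, hj⟩ => hc ⟨j, hj.symm⟩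
      simp [this]
  obtain ⟨n, hn⟩ : ∃ n, n = d 1 * m + (d 1 - 1) := ⟨_, rfl⟩
  have e2 : ∀ k, (s d p n k : ℂ) * w k = ((1 - p 1) * (if k = n then w n else 0)) +
      p 1 * ((if d 1 ∣ k then (s (shd d) (shp p) m (k / d 1) : ℂ) else 0) * w k) := by
    intro k
    rw [hn, h.s_rec2]
    by_cases hk : k = d 1 * m + (d 1 - 1)
    · subst hk
      split_ifs <;> simp <;> ring
    · simp only [hk, if_false]
      split_ifs <;> simp
      ring
  have hs : Summable fun k => ((if d 1 ∣ k then (s (shd d) (shp p) m (k / d 1) : ℂ) else 0) * w k) := by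
    apply summable_of_ne_finset_zero (s := range (d 1 * (m + 2)))
    intro k hk
    simp at hk
    have : m + 2 ≤ k / d 1 := by
      rw [Nat.le_div_iff_mul_le (by omega)]; linarith
    rw [h.shift.s_far (by omega)]; simp
  rw [← hn, e1]
  conv_lhs => rw [Sop]
  rw [tsum_congr e2, Summable.tsum_add _ (hs.mul_left _), tsum_mul_left, tsum_mul_left]
  · simp
  · apply Summable.mul_left
    exact summable_of_ne_finset_zero (s := {n}) (by intro k hk; simp at hk; simp [hk])

theorem Mach.Sop_one {d : ℕ → ℕ} {p : ℕ → ℝ} (h : Mach d p) (n : ℕ) :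
    Sop d p (fun _ => 1) n = 1 := by
  induction n using Nat.strong_induction_on generalizing d p with
  | _ n ih =>
    rcases h.cases n with hc | ⟨m, hm, hc⟩
    · rw [h.Sop_rec1 _ n hc]; ring
    · rw [hc, h.Sop_rec2, ih m hm h.shift]; ring

theorem Mach.row_sum {d : ℕ → ℕ} {p : ℕ → ℝ} (h : Mach d p) (n N : ℕ) (hN : n + 2 ≤ N) :
    ∑ m ∈ range N, s d p n m = 1 := by
  have := h.Sop_one n
  rw [h.Sop_eq _ n N hN] at this
  simp only [mul_one] at this
  exact_mod_cast this

theorem block_sum (D : ℕ) (hD : 2 ≤ D) (F : ℕ → ℝ) (hF : ∀ m, 0 ≤ F m) (M : ℕ) :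
    ∑ n ∈ range (M + 1), (if n % D + 1 = D then F (n / D) else 0) ≤ ∑ m ∈ range M, F m := by
  rw [← Finset.sum_filter]
  have key : ∀ n ∈ (range (M + 1)).filter (fun n => n % D + 1 = D), D * (n / D) + (D - 1) = n := by
    intro n hn
    simp at hn
    have := Nat.div_add_mod n D
    omega
  rw [← Finset.sum_image (s := (range (M + 1)).filter (fun n => n % D + 1 = D))
    (g := fun n => n / D) (f := F)]
  · apply Finset.sum_le_sum_of_subset_of_nonneg
    · intro m hm
      rw [Finset.mem_image] at hm
      obtain ⟨n, hn, rfl⟩ := hm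
      have h1 := key n hn
      simp at hn ⊢
      have := Nat.mul_le_mul_right (n / D) hD
      omega
    · intros; apply hF
  · intro a ha b hb hab
    have h1 := key a ha
    have h2 := key b hb
    simp only at hab
    rw [← h1, ← h2, hab]

theorem Mach.col_sum {d : ℕ → ℕ} {p : ℕ → ℝ} (h : Mach d p) (N k : ℕ) :
    ∑ n ∈ range N, s d p n k ≤ 1 := by
  induction N generalizing d p k with
  | zero => simp
  | succ M ih =>
    have hd1 := h.hd 1 le_rfl
    obtain ⟨h1, h2⟩ := h.hp 1 le_rfl
    have h3 : 0 ≤ 1 - p 1 := by linarith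
    have hone : ∀ j, ∑ n ∈ range (M + 1), (if n = j then (1 : ℝ) else 0) ≤ 1 := by
      intro j
      rw [Finset.sum_ite_eq']
      split_ifs <;> norm_num
    by_cases hk : d 1 ∣ k
    · have hb := block_sum (d 1) hd1 (fun m => s (shd d) (shp p) m (k / d 1))
        (fun m => h.shift.s_nonneg _ _) M
      have hle : ∀ n ∈ range (M + 1), s d p n k ≤ (1 - p 1) * (if n = k then (1 : ℝ) else 0) +
          p 1 * (if n % d 1 + 1 = d 1 then s (shd d) (shp p) (n / d 1) (k / d 1) else 0) := by
        intro n _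
        rcases h.cases n with hc | ⟨m, hm, hc⟩
        · rw [h.s_rec1 n k hc]
          have hne : k ≠ n + 1 := by
            rintro rfl
            rw [Nat.dvd_iff_mod_eq_zero, Nat.add_mod] at hk
            rw [Nat.mod_eq_of_lt (by omega : 1 < d 1), Nat.mod_eq_of_lt hc] at hk
            omega
          have hne2 : ¬ (n % d 1 + 1 = d 1) := by omega
          simp [hne, hne2, eq_comm]
        · have hmod : n % d 1 + 1 = d 1 := by
            rw [hc, Nat.mul_add_mod, Nat.mod_eq_of_lt (by omega)]; omega
          have hdiv : n / d 1 = m := by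
            rw [hc, Nat.mul_add_div (by omega), Nat.div_eq_of_lt (by omega)]; omega
          rw [if_pos hmod, hdiv]
          conv_lhs => rw [hc, h.s_rec2, ← hc]
          simp [hk, eq_comm]
      refine (Finset.sum_le_sum hle).trans ?_
      rw [Finset.sum_add_distrib, ← Finset.mul_sum, ← Finset.mul_sum]
      have := hone k
      have := ih h.shift (k / d 1)
      nlinarith
    · have hle : ∀ n ∈ range (M + 1), s d p n k ≤ (1 - p 1) * (if n = k then (1 : ℝ) else 0) +
          p 1 * (if n = k - 1 then (1 : ℝ) else 0) := by
        intro n _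
        have hk0 : k ≠ 0 := by rintro rfl; simp at hk
        rcases h.cases n with hc | ⟨m, hm, hc⟩
        · rw [h.s_rec1 n k hc]
          apply le_of_eq
          congr 2
          · simp [eq_comm]
          · by_cases hh : k = n + 1
            · simp [hh]
            · rw [if_neg hh, if_neg (by omega)]
        · conv_lhs => rw [hc, h.s_rec2, ← hc]
          have : 0 ≤ p 1 * (if n = k - 1 then (1 : ℝ) else 0) := by positivity
          simp only [hk, if_false, mul_zero, add_zero, eq_comm (a := k)]
          linarith
      refine (Finset.sum_le_sum hle).trans ?_
      rw [Finset.sum_add_distrib, ← Finset.mul_sum, ← Finset.mul_sum]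
      have := hone k
      have := hone (k - 1)
      nlinarith

theorem ftil_shift (d : ℕ → ℕ) (p : ℕ → ℝ) (k : ℕ) (z : ℂ) :
    ftil (shd d) (shp p) k (f d p 1 z) = ftil d p (k + 1) z := by
  induction k with
  | zero => simp [ftil]
  | succ k ih =>
    show f (shd d) (shp p) (k + 1) (ftil (shd d) (shp p) k (f d p 1 z)) = _
    rw [ih]
    simp [ftil, f, shd, shp]

/-- Truncated eigenvectors. -/
def wk : ℕ → (ℕ → ℕ) → (ℕ → ℝ) → ℂ → ℕ → ℂ
  | 0, _, _, _, n => if n = 0 then 1 else 0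
  | k + 1, d, p, z, n =>
    ((z - (1 - (p 1 : ℂ))) / (p 1 : ℂ)) ^ (n % d 1) *
      wk k (shd d) (shp p) (f d p 1 z) (n / d 1)

theorem wk_zero (k : ℕ) (d : ℕ → ℕ) (p : ℕ → ℝ) (z : ℂ) : wk k d p z 0 = 1 := by
  induction k generalizing d p z with
  | zero => simp [wk]
  | succ k ih => simp [wk, ih]

theorem Mach.wk_supp {d : ℕ → ℕ} {p : ℕ → ℝ} (h : Mach d p) (k : ℕ) (z : ℂ) :
    ∃ N, ∀ n, N ≤ n → wk k d p z n = 0 := by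
  induction k generalizing d p z with
  | zero => exact ⟨1, fun n hn => by simp [wk]; omega⟩
  | succ k ih =>
    obtain ⟨N, hN⟩ := ih h.shift (f d p 1 z)
    refine ⟨N * d 1, fun n hn => ?_⟩
    have hd1 := h.hd 1 le_rfl
    rw [wk, hN, mul_zero]
    rwa [Nat.le_div_iff_mul_le (by omega)]

theorem Mach.wk_succ {d : ℕ → ℕ} {p : ℕ → ℝ} (h : Mach d p) (k n : ℕ) (z : ℂ) (hn : n ≤ k) :
    wk (k + 1) d p z n = wk k d p z n := by
  induction k generalizing d p z n with
  | zero =>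
    have : n = 0 := by omega
    subst this; simp [wk_zero]
  | succ k ih =>
    rw [wk, ih h.shift]
    · rfl
    have hd1 := h.hd 1 le_rfl
    by_cases h0 : n = 0
    · subst h0; simp
    have := Nat.div_lt_self (by omega : 0 < n) (by omega : 1 < d 1)
    omega

theorem Mach.wk_stable {d : ℕ → ℕ} {p : ℕ → ℝ} (h : Mach d p) (k n : ℕ) (z : ℂ) (hn : n ≤ k) :
    wk k d p z n = wk n d p z n := by
  induction k, hn using Nat.le_induction with
  | base => rfl
  | succ k hk ih => rw [h.wk_succ k n z hk, ih]

/-- Residuals. -/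
def res (k : ℕ) (d : ℕ → ℕ) (p : ℕ → ℝ) (z : ℂ) (n : ℕ) : ℂ :=
  Sop d p (wk k d p z) n - z * wk k d p z n

theorem Mach.res_rec1 {d : ℕ → ℕ} {p : ℕ → ℝ} (h : Mach d p) (k n : ℕ) (z : ℂ)
    (hn : n % d 1 + 1 < d 1) : res (k + 1) d p z n = 0 := by
  have hd1 := h.hd 1 le_rfl
  have hp1 : (p 1 : ℂ) ≠ 0 := by exact_mod_cast (h.hp 1 le_rfl).1.ne'
  have hmod : (n + 1) % d 1 = n % d 1 + 1 := by
    rw [Nat.add_mod, Nat.mod_eq_of_lt (by omega : 1 < d 1), Nat.mod_eq_of_lt hn]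
  have hdiv : (n + 1) / d 1 = n / d 1 := by
    have h1 := Nat.div_add_mod n (d 1)
    have h2 := Nat.div_add_mod (n + 1) (d 1)
    rw [hmod] at h2
    exact Nat.eq_of_mul_eq_mul_left (by omega : 0 < d 1) (by omega)
  rw [res, h.Sop_rec1 _ n hn, wk, wk, hmod, hdiv, pow_succ]
  field_simp
  ring

theorem Mach.res_rec2 {d : ℕ → ℕ} {p : ℕ → ℝ} (h : Mach d p) (k m : ℕ) (z : ℂ) :
    res (k + 1) d p z (d 1 * m + (d 1 - 1)) = p 1 * res k (shd d) (shp p) (f d p 1 z) m := by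
  have hd1 := h.hd 1 le_rfl
  have hp1 : (p 1 : ℂ) ≠ 0 := by exact_mod_cast (h.hp 1 le_rfl).1.ne'
  obtain ⟨n, hn⟩ : ∃ n, n = d 1 * m + (d 1 - 1) := ⟨_, rfl⟩
  have hmod : n % d 1 = d 1 - 1 := by
    rw [hn, Nat.mul_add_mod, Nat.mod_eq_of_lt (by omega)]
  have hdiv : n / d 1 = m := by
    rw [hn, Nat.mul_add_div (by omega), Nat.div_eq_of_lt (by omega)]; omega
  have e : (fun j => wk (k + 1) d p z (d 1 * j)) = wk k (shd d) (shp p) (f d p 1 z) := by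
    funext j
    simp [wk, Nat.mul_div_cancel_left _ (by omega : 0 < d 1)]
  have e2 : wk (k + 1) d p z n = ((z - (1 - (p 1 : ℂ))) / (p 1 : ℂ)) ^ (d 1 - 1) *
      wk k (shd d) (shp p) (f d p 1 z) m := by
    rw [wk, hmod, hdiv]
  rw [res, h.Sop_rec2, e, res, ← hn, e2]
  have e3 : f d p 1 z = ((z - (1 - (p 1 : ℂ))) / (p 1 : ℂ)) ^ (d 1 - 1) *
      ((z - (1 - (p 1 : ℂ))) / (p 1 : ℂ)) := by
    rw [← pow_succ, f]; congr 1; omega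
  have e4 : (p 1 : ℂ) * ((z - (1 - (p 1 : ℂ))) / (p 1 : ℂ)) = z - (1 - p 1) := by
    field_simp
  generalize Sop (shd d) (shp p) (wk k (shd d) (shp p) (f d p 1 z)) m = A
  generalize wk k (shd d) (shp p) (f d p 1 z) m = B
  rw [e3]
  generalize ((z - (1 - (p 1 : ℂ))) / (p 1 : ℂ)) = C at *
  linear_combination (C ^ (d 1 - 1) * B) * e4

theorem Mach.res_eq_zero {d : ℕ → ℕ} {p : ℕ → ℝ} (h : Mach d p) (k n : ℕ) (z : ℂ) (hn : n < k) :
    res k d p z n = 0 := by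
  induction k generalizing d p z n with
  | zero => omega
  | succ k ih =>
    rcases h.cases n with hc | ⟨m, hm, hc⟩
    · exact h.res_rec1 k n z hc
    · rw [hc, h.res_rec2, ih h.shift m _ (by omega), mul_zero]

theorem Mach.res_sum {d : ℕ → ℕ} {p : ℕ → ℝ} (h : Mach d p) (k N : ℕ) (z : ℂ) :
    ∑ n ∈ range N, ‖res k d p z n‖ ≤ 1 + ‖ftil d p k z‖ := by
  induction k generalizing d p z N with
  | zero =>
    have e : ∀ n ∈ range N, ‖res 0 d p z n‖ ≤ s d p n 0 + (if n = 0 then ‖z‖ else 0) := by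
      intro n _
      have : Sop d p (wk 0 d p z) n = s d p n 0 := by
        rw [h.Sop_eq _ n _ le_rfl]
        simp [wk]
      rw [res, this]
      refine (norm_sub_le _ _).trans ?_
      rw [Complex.norm_real, Real.norm_of_nonneg (h.s_nonneg _ _)]
      by_cases h0 : n = 0
      · simp [h0, wk]
      · simp [h0, wk]
    refine (Finset.sum_le_sum e).trans ?_
    rw [Finset.sum_add_distrib]
    refine add_le_add (h.col_sum N 0) ?_
    rw [Finset.sum_ite_eq']
    simp only [ftil, id]
    split_ifs
    · exact le_rfl
    · positivity
  | succ k ih =>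
    rcases N with _ | M
    · simp; positivity
    have hd1 := h.hd 1 le_rfl
    obtain ⟨hp1, hp2⟩ := h.hp 1 le_rfl
    have hb := block_sum (d 1) hd1 (fun m => ‖res k (shd d) (shp p) (f d p 1 z) m‖)
        (fun m => norm_nonneg _) M
    have e : ∀ n ∈ range (M + 1), ‖res (k + 1) d p z n‖ ≤
        (if n % d 1 + 1 = d 1 then ‖res k (shd d) (shp p) (f d p 1 z) (n / d 1)‖ else 0) := by
      intro n _
      rcases h.cases n with hc | ⟨m, hm, hc⟩
      · rw [h.res_rec1 k n z hc, norm_zero]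
        split_ifs <;> positivity
      · have hmod : n % d 1 + 1 = d 1 := by
          rw [hc, Nat.mul_add_mod, Nat.mod_eq_of_lt (by omega)]; omega
        have hdiv : n / d 1 = m := by
          rw [hc, Nat.mul_add_div (by omega), Nat.div_eq_of_lt (by omega)]; omega
        rw [if_pos hmod, hdiv, hc, h.res_rec2, norm_mul, Complex.norm_real,
          Real.norm_of_nonneg hp1.le]
        exact mul_le_of_le_one_left (norm_nonneg _) hp2
    refine (Finset.sum_le_sum e).trans (hb.trans ?_)
    rw [← ftil_shift]
    exact ih h.shift M _

theorem Mach.res_le {d : ℕ → ℕ} {p : ℕ → ℝ} (h : Mach d p) (k n : ℕ) (z : ℂ) :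
    ‖res k d p z n‖ ≤ 1 + ‖ftil d p k z‖ :=
  (Finset.single_le_sum (f := fun n => ‖res k d p z n‖) (fun _ _ => norm_nonneg _)
    (Finset.self_mem_range_succ n)).trans (h.res_sum k (n + 1) z)

theorem Mach.eigen {d : ℕ → ℕ} {p : ℕ → ℝ} (h : Mach d p) (z : ℂ) (n : ℕ) :
    Sop d p (fun n => wk n d p z n) n = z * wk n d p z n := by
  have h1 := h.res_eq_zero (n + 2) n z (by omega)
  rw [res, sub_eq_zero, h.wk_stable (n + 2) n z (by omega)] at h1
  rw [← h1, h.Sop_eq _ n _ le_rfl, h.Sop_eq _ n _ le_rfl]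
  refine Finset.sum_congr rfl fun m hm => ?_
  rw [h.wk_stable (n + 2) m z (by simp at hm; omega)]

theorem E_iff (d : ℕ → ℕ) (p : ℕ → ℝ) (z : ℂ) (hz : z ∈ E d p) :
    ∃ C : ℝ, ∀ k, ‖ftil d p k z‖ ≤ C := by
  have hz' : Filter.limsup (fun j => (‖ftil d p j z‖₊ : ℝ≥0∞)) Filter.atTop < ⊤ := hz
  obtain ⟨b, hb1, hb2⟩ := ENNReal.lt_iff_exists_nnreal_btwn.1 hz'
  have h1 := Filter.eventually_lt_of_limsup_lt hb1
  obtain ⟨K, hK⟩ := Filter.eventually_atTop.1 h1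
  refine ⟨b + ∑ k ∈ range K, ‖ftil d p k z‖, fun k => ?_⟩
  by_cases hk : K ≤ k
  · have := hK k hk
    have h2 : ‖ftil d p k z‖₊ < b := by exact_mod_cast this
    have h3 : ‖ftil d p k z‖ < b := by exact_mod_cast h2
    have : 0 ≤ ∑ k ∈ range K, ‖ftil d p k z‖ := Finset.sum_nonneg fun _ _ => norm_nonneg _
    linarith
  · have := Finset.single_le_sum (f := fun k => ‖ftil d p k z‖) (fun _ _ => norm_nonneg _)
      (Finset.mem_range.2 (by omega : k < K))
    have hb : (0 : ℝ) ≤ b := b.2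
    linarith

theorem not_E (d : ℕ → ℕ) (p : ℕ → ℝ) (z : ℂ) (hz : z ∉ E d p) :
    ∃ k, 1 < ‖ftil d p k z‖ := by
  by_contra hc
  push Not at hc
  apply hz
  show Filter.limsup (fun j => (‖ftil d p j z‖₊ : ℝ≥0∞)) Filter.atTop < ⊤
  refine lt_of_le_of_lt (Filter.limsup_le_of_le (a := 1) (by isBoundedDefault) ?_) ENNReal.one_lt_top
  refine Filter.Eventually.of_forall fun k => ?_
  have : ‖ftil d p k z‖₊ ≤ 1 := by exact_mod_cast hc k
  exact_mod_cast this

theorem Mach.one_mem_E {d : ℕ → ℕ} {p : ℕ → ℝ} (h : Mach d p) : (1 : ℂ) ∈ E d p := by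
  by_contra hc
  obtain ⟨k, hk⟩ := not_E d p 1 hc
  have : ftil d p k 1 = 1 := by
    clear hk
    induction k with
    | zero => simp [ftil]
    | succ k ih =>
      have hp1 : (p (k + 1) : ℂ) ≠ 0 := by exact_mod_cast (h.hp (k + 1) (by omega)).1.ne'
      simp [ftil, ih, f, hp1]
  rw [this] at hk
  simp at hk

/-- forward recursion of the inhomogeneous terms -/
def hh (D : ℕ) (mu c : ℂ) (g : ℕ → ℂ) : ℕ → ℕ → ℂ
  | 0, _ => 0
  | a + 1, m => mu * hh D mu c g a m + c * g (D * m + a)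

theorem Mach.solve_iff {d : ℕ → ℕ} {p : ℕ → ℝ} (h : Mach d p) (z mu : ℂ)
    (hmu : mu = (z - (1 - (p 1 : ℂ))) / (p 1 : ℂ)) (g w : ℕ → ℂ) :
    (∀ n, Sop d p w n - z * w n = g n) ↔
    (∀ m a, a < d 1 → w (d 1 * m + a) = mu ^ a * w (d 1 * m) + hh (d 1) mu (p 1 : ℂ)⁻¹ g a m) ∧
    (∀ m, Sop (shd d) (shp p) (fun j => w (d 1 * j)) m - f d p 1 z * w (d 1 * m)
      = hh (d 1) mu (p 1 : ℂ)⁻¹ g (d 1) m) := by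
  have hd1 := h.hd 1 le_rfl
  have hp1 : (p 1 : ℂ) ≠ 0 := by exact_mod_cast (h.hp 1 le_rfl).1.ne'
  have hz : z = (1 - p 1) + p 1 * mu := by rw [hmu]; field_simp; ring
  have hf : f d p 1 z = mu * mu ^ (d 1 - 1) := by
    rw [f, ← hmu, ← pow_succ']; congr 1; omega
  have hD : ∀ m, hh (d 1) mu (p 1 : ℂ)⁻¹ g (d 1) m =
      mu * hh (d 1) mu (p 1 : ℂ)⁻¹ g (d 1 - 1) m + (p 1 : ℂ)⁻¹ * g (d 1 * m + (d 1 - 1)) := by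
    intro m
    obtain ⟨e, he⟩ : ∃ e, d 1 = e + 1 := ⟨d 1 - 1, by omega⟩
    rw [he]; rfl
  have hinv : (p 1 : ℂ) * (p 1 : ℂ)⁻¹ = 1 := mul_inv_cancel₀ hp1
  have hmod : ∀ m a, a < d 1 → (d 1 * m + a) % d 1 = a := fun m a ha => by
    rw [Nat.mul_add_mod, Nat.mod_eq_of_lt ha]
  constructor
  · intro hs
    have h1 : ∀ m a, a < d 1 →
        w (d 1 * m + a) = mu ^ a * w (d 1 * m) + hh (d 1) mu (p 1 : ℂ)⁻¹ g a m := by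
      intro m a
      induction a with
      | zero => intro _; simp [hh]
      | succ a ih =>
        intro ha
        have h2 := hs (d 1 * m + a)
        have h3 := ih (by omega)
        rw [h.Sop_rec1 _ _ (by rw [hmod _ _ (by omega)]; exact ha)] at h2
        have h4 : w (d 1 * m + a + 1) = mu * w (d 1 * m + a) + (p 1 : ℂ)⁻¹ * g (d 1 * m + a) := by
          rw [← h2, hz]; field_simp; ring
        rw [← add_assoc, h4, h3, hh]; ring
    refine ⟨h1, fun m => ?_⟩
    have h2 := hs (d 1 * m + (d 1 - 1))
    rw [h.Sop_rec2] at h2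
    have h3 := h1 m (d 1 - 1) (by omega)
    have h4 : Sop (shd d) (shp p) (fun j => w (d 1 * j)) m =
        mu * w (d 1 * m + (d 1 - 1)) + (p 1 : ℂ)⁻¹ * g (d 1 * m + (d 1 - 1)) := by
      rw [← h2, hz]; field_simp; ring
    rw [h4, h3, hD, hf]; ring
  · rintro ⟨h1, h2⟩ n
    rcases h.cases n with hc | ⟨m, hm, hc⟩
    · rw [h.Sop_rec1 _ _ hc]
      have e1 := Nat.div_add_mod n (d 1)
      have h3 := h1 (n / d 1) (n % d 1) (by omega)
      have h4 := h1 (n / d 1) (n % d 1 + 1) hc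
      rw [← add_assoc, e1, hh, e1, pow_succ] at h4
      rw [e1] at h3
      rw [h4, h3, hz]
      field_simp
      ring
    · rw [hc, h.Sop_rec2]
      have h3 := h1 m (d 1 - 1) (by omega)
      have h4 := h2 m
      rw [hD, hf, sub_eq_iff_eq_add] at h4
      rw [h4, h3, hz]
      field_simp
      ring

/-- Unique solvability of `(S - z) w = g` in `X`. -/
def Solv (X : Submodule ℂ (ℕ → ℂ)) (d : ℕ → ℕ) (p : ℕ → ℝ) (z : ℂ) : Prop :=
  ∀ g ∈ X, ∃! w : ℕ → ℂ, w ∈ X ∧ ∀ n, Sop d p w n - z * w n = g n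

/-- `S` preserves `X`. -/
def Pres (X : Submodule ℂ (ℕ → ℂ)) (d : ℕ → ℕ) (p : ℕ → ℝ) : Prop :=
  ∀ w ∈ X, Sop d p w ∈ X

/-- Admissible sequence spaces -/
structure Good (X : Submodule ℂ (ℕ → ℂ)) : Prop where
  restr : ∀ D a : ℕ, 2 ≤ D → ∀ w ∈ X, (fun m => w (D * m + a)) ∈ X
  glue : ∀ D : ℕ, 2 ≤ D → ∀ w : ℕ → ℂ, (∀ a < D, (fun m => w (D * m + a)) ∈ X) → w ∈ X
  base : ∀ d p, Mach d p → Pres X d p → ∀ z : ℂ, 1 < ‖z‖ → Solv X d p z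

theorem Good.pres {X : Submodule ℂ (ℕ → ℂ)} (hX : Good X) {d : ℕ → ℕ} {p : ℕ → ℝ} (h : Mach d p)
    (hP : Pres X d p) : Pres X (shd d) (shp p) := by
  intro w hw
  have hd1 := h.hd 1 le_rfl
  have hp1 : (p 1 : ℂ) ≠ 0 := by exact_mod_cast (h.hp 1 le_rfl).1.ne'
  have hmod : ∀ m a, a < d 1 → (d 1 * m + a) % d 1 = a := fun m a ha => by
    rw [Nat.mul_add_mod, Nat.mod_eq_of_lt ha]
  have h1 : (fun n => if n % d 1 = 0 then w (n / d 1) else 0) ∈ X := by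
    apply hX.glue (d 1) hd1
    intro a ha
    by_cases h0 : a = 0
    · subst h0
      convert hw using 2 with m
      simp [Nat.mul_div_cancel_left _ (by omega : 0 < d 1)]
    · convert X.zero_mem using 2 with m
      simp only [hmod m a ha, h0, if_false, Pi.zero_apply]
  have h2 := hX.restr (d 1) (d 1 - 1) hd1 _ (hP _ h1)
  convert X.smul_mem (p 1 : ℂ)⁻¹ h2 using 1
  funext m
  show Sop (shd d) (shp p) w m = (p 1 : ℂ)⁻¹ * Sop d p _ (d 1 * m + (d 1 - 1))
  rw [h.Sop_rec2, hmod _ _ (by omega), if_neg (by omega)]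
  have : (fun j => if d 1 * j % d 1 = 0 then w (d 1 * j / d 1) else 0) = w := by
    funext j
    simp [Nat.mul_div_cancel_left _ (by omega : 0 < d 1)]
  rw [this]
  field_simp
  ring

theorem Good.hh_mem {X : Submodule ℂ (ℕ → ℂ)} (hX : Good X) (D : ℕ) (hD : 2 ≤ D) (mu c : ℂ)
    (g : ℕ → ℂ) (hg : g ∈ X) (a : ℕ) : hh D mu c g a ∈ X := by
  induction a with
  | zero => exact X.zero_mem
  | succ a ih => exact X.add_mem (X.smul_mem mu ih) (X.smul_mem c (hX.restr D a hD g hg))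

theorem Good.solv {X : Submodule ℂ (ℕ → ℂ)} (hX : Good X) (k : ℕ) {d : ℕ → ℕ} {p : ℕ → ℝ}
    (h : Mach d p) (hP : Pres X d p) (z : ℂ) (hz : 1 < ‖ftil d p k z‖) : Solv X d p z := by
  induction k generalizing d p z with
  | zero => exact hX.base d p h hP z hz
  | succ k ih =>
    rw [← ftil_shift] at hz
    have IH := ih h.shift (hX.pres h hP) _ hz
    intro g hg
    have hd1 := h.hd 1 le_rfl
    obtain ⟨mu, hmu⟩ : ∃ mu, mu = (z - (1 - (p 1 : ℂ))) / (p 1 : ℂ) := ⟨_, rfl⟩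
    have hmem := hX.hh_mem (d 1) hd1 mu (p 1 : ℂ)⁻¹ g hg
    obtain ⟨w0, ⟨hw0, hs0⟩, huniq⟩ := IH _ (hmem (d 1))
    have hmod : ∀ m a, a < d 1 → (d 1 * m + a) % d 1 = a := fun m a ha => by
      rw [Nat.mul_add_mod, Nat.mod_eq_of_lt ha]
    have hdiv : ∀ m a, a < d 1 → (d 1 * m + a) / d 1 = m := fun m a ha => by
      rw [Nat.mul_add_div (by omega), Nat.div_eq_of_lt ha]; omega
    have hdiv0 : ∀ m, d 1 * m / d 1 = m := fun m => hdiv m 0 (by omega)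
    refine ⟨fun n => mu ^ (n % d 1) * w0 (n / d 1) + hh (d 1) mu (p 1 : ℂ)⁻¹ g (n % d 1) (n / d 1),
      ⟨?_, ?_⟩, ?_⟩
    · apply hX.glue (d 1) hd1
      intro a ha
      simp only [hmod _ a ha, hdiv _ a ha]
      exact X.add_mem (X.smul_mem _ hw0) (hmem a)
    · rw [h.solve_iff z mu hmu]
      constructor
      · intro m a ha
        simp only [hmod _ a ha, hdiv _ a ha, Nat.mul_mod_right, hdiv0, pow_zero, one_mul, hh,
          add_zero]
      · intro m
        simp only [Nat.mul_mod_right, hdiv0, pow_zero, one_mul, hh, add_zero]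
        exact hs0 m
    · rintro w ⟨hw, hs⟩
      rw [h.solve_iff z mu hmu] at hs
      have e : (fun j => w (d 1 * j)) = w0 :=
        huniq _ ⟨hX.restr (d 1) 0 hd1 w hw, hs.2⟩
      funext n
      have h1 := hs.1 (n / d 1) (n % d 1) (Nat.mod_lt _ (by omega))
      rw [Nat.div_add_mod] at h1
      rw [h1, ← e]

section generic
variable {M : Type*} [NormedAddCommGroup M] [NormedSpace ℂ M] [CompleteSpace M]

theorem not_spec_iff (T : M →L[ℂ] M) (z : ℂ) :
    z ∉ spectrum ℂ T ↔ Function.Bijective ⇑(T - z • (1 : M →L[ℂ] M)) := by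
  rw [spectrum.notMem_iff, ← IsUnit.neg_iff, ← ContinuousLinearMap.isUnit_iff_bijective,
    neg_sub, Algebra.algebraMap_eq_smul_one]

theorem solv_iff {X : Submodule ℂ (ℕ → ℂ)} {d : ℕ → ℕ} {p : ℕ → ℝ}
    (e : M →ₗ[ℂ] (ℕ → ℂ)) (he : Function.Injective e) (hX : ∀ w, w ∈ X ↔ ∃ x, e x = w)
    (T : M →L[ℂ] M) (hT : ∀ x, e (T x) = Sop d p (e x)) (z : ℂ) :
    Solv X d p z ↔ z ∉ spectrum ℂ T := by
  rw [not_spec_iff, Function.bijective_iff_existsUnique]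
  have key : ∀ x g, (T - z • (1 : M →L[ℂ] M)) x = g ↔ ∀ n, Sop d p (e x) n - z * e x n = e g n := by
    intro x g
    rw [← he.eq_iff, funext_iff]
    simp [hT]
  constructor
  · intro h g
    obtain ⟨w, ⟨hw, hs⟩, hu⟩ := h (e g) ((hX _).2 ⟨g, rfl⟩)
    obtain ⟨x, rfl⟩ := (hX _).1 hw
    refine ⟨x, (key x g).2 hs, fun y hy => he (hu _ ⟨(hX _).2 ⟨y, rfl⟩, (key y g).1 hy⟩)⟩
  · intro h g hg
    obtain ⟨g, rfl⟩ := (hX _).1 hg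
    obtain ⟨x, hx, hu⟩ := h g
    refine ⟨e x, ⟨(hX _).2 ⟨x, rfl⟩, (key x g).1 hx⟩, ?_⟩
    rintro w ⟨hw, hs⟩
    obtain ⟨y, rfl⟩ := (hX _).1 hw
    rw [hu y ((key y g).2 hs)]

theorem base_gen {X : Submodule ℂ (ℕ → ℂ)} {d : ℕ → ℕ} {p : ℕ → ℝ} (h : Mach d p)
    (e : M →ₗ[ℂ] (ℕ → ℂ)) (he : Function.Injective e) (hX : ∀ w, w ∈ X ↔ ∃ x, e x = w)
    (hP : Pres X d p) (hb : ∀ x y : M, e y = Sop d p (e x) → ‖y‖ ≤ ‖x‖) (z : ℂ) (hz : 1 < ‖z‖) :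
    Solv X d p z := by
  have hex : ∀ x : M, ∃ y, e y = Sop d p (e x) := fun x => (hX _).1 (hP _ ((hX _).2 ⟨x, rfl⟩))
  choose t ht using hex
  let L : M →ₗ[ℂ] M :=
    { toFun := t
      map_add' := fun x y => he (by
        rw [map_add, ht, ht, ht, map_add]; funext n; exact h.Sop_add _ _ n)
      map_smul' := fun c x => he (by
        rw [map_smul, ht, ht, map_smul]; funext n; exact h.Sop_smul _ _ n) }
  let T : M →L[ℂ] M := L.mkContinuous 1 (fun x => by rw [one_mul]; exact hb x (t x) (ht x))
  have hTn : ‖T‖ ≤ 1 := L.mkContinuous_norm_le zero_le_one _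
  rw [solv_iff e he hX T ht]
  intro hmem
  have h1 := spectrum.norm_le_norm_mul_of_mem hmem
  have h2 : ‖(1 : M →L[ℂ] M)‖ ≤ 1 := ContinuousLinearMap.norm_id_le
  nlinarith [norm_nonneg T, norm_nonneg (1 : M →L[ℂ] M)]

end generic

/-! c0 -/

/-- null sequences -/
def X0 : Submodule ℂ (ℕ → ℂ) where
  carrier := {w | Tendsto w atTop (𝓝 0)}
  add_mem' := fun {a b} ha hb => by
    have := Filter.Tendsto.add ha hb
    rw [add_zero] at this
    exact this
  zero_mem' := tendsto_const_nhds
  smul_mem' := fun c w hw => by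
    have := Filter.Tendsto.const_mul c hw
    rw [mul_zero] at this
    exact this

theorem c0_tendsto (x : C₀(ℕ, ℂ)) : Tendsto (fun n => x n) atTop (𝓝 0) := by
  have := x.zero_at_infty'
  rwa [cocompact_eq_cofinite, Nat.cofinite_eq_atTop] at this

/-- constructor -/
def mk0 (w : ℕ → ℂ) (hw : Tendsto w atTop (𝓝 0)) : C₀(ℕ, ℂ) where
  toFun := w
  continuous_toFun := continuous_of_discreteTopology
  zero_at_infty' := by rwa [cocompact_eq_cofinite, Nat.cofinite_eq_atTop]

@[simp] theorem mk0_apply (w : ℕ → ℂ) (hw : Tendsto w atTop (𝓝 0)) (n : ℕ) : mk0 w hw n = w n := rfl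

theorem c0_norm_le (x : C₀(ℕ, ℂ)) (C : ℝ) (hC : 0 ≤ C) (h : ∀ n, ‖x n‖ ≤ C) : ‖x‖ ≤ C := by
  rw [← ZeroAtInftyContinuousMap.norm_toBCF_eq_norm]
  exact (BoundedContinuousFunction.norm_le hC).2 h

theorem c0_apply_le (x : C₀(ℕ, ℂ)) (n : ℕ) : ‖x n‖ ≤ ‖x‖ := by
  rw [← ZeroAtInftyContinuousMap.norm_toBCF_eq_norm]
  exact x.toBCF.norm_coe_le_norm n

/-- coercion as a linear map -/
def e0 : C₀(ℕ, ℂ) →ₗ[ℂ] (ℕ → ℂ) where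
  toFun := fun x => ⇑x
  map_add' := fun _ _ => rfl
  map_smul' := fun _ _ => rfl

theorem e0_inj : Function.Injective e0 := DFunLike.coe_injective

theorem mem_X0 (w : ℕ → ℂ) : w ∈ X0 ↔ ∃ x, e0 x = w :=
  ⟨fun h => ⟨mk0 w h, rfl⟩, by rintro ⟨x, rfl⟩; exact c0_tendsto x⟩

theorem Mach.Sop_norm_le {d : ℕ → ℕ} {p : ℕ → ℝ} (h : Mach d p) (w : ℕ → ℂ) (n : ℕ) :
    ‖Sop d p w n‖ ≤ ∑ m ∈ range (n + 2), s d p n m * ‖w m‖ := by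
  rw [h.Sop_eq w n _ le_rfl]
  refine (norm_sum_le _ _).trans (le_of_eq (Finset.sum_congr rfl fun m _ => ?_))
  rw [norm_mul, Complex.norm_real, Real.norm_of_nonneg (h.s_nonneg _ _)]

theorem tendsto_glue (D : ℕ) (hD : 2 ≤ D) (w : ℕ → ℂ)
    (hw : ∀ a < D, Tendsto (fun m => w (D * m + a)) atTop (𝓝 0)) : Tendsto w atTop (𝓝 0) := by
  rw [Metric.tendsto_atTop]
  intro ε hε
  have h1 : ∀ a, ∃ N, a < D → ∀ n ≥ N, dist (w (D * n + a)) 0 < ε := by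
    intro a
    by_cases ha : a < D
    · obtain ⟨N, hN⟩ := Metric.tendsto_atTop.1 (hw a ha) ε hε
      exact ⟨N, fun _ => hN⟩
    · exact ⟨0, fun h => absurd h ha⟩
  choose N hN using h1
  refine ⟨D * ∑ a ∈ range D, N a, fun n hn => ?_⟩
  have h2 := Nat.mod_lt n (by omega : 0 < D)
  have h3 := hN (n % D) h2 (n / D) (by
    have : N (n % D) ≤ ∑ a ∈ range D, N a :=
      Finset.single_le_sum (f := N) (fun _ _ => Nat.zero_le _) (Finset.mem_range.2 h2)
    refine le_trans this ?_
    rw [Nat.le_div_iff_mul_le (by omega), mul_comm]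
    exact hn)
  rwa [Nat.div_add_mod] at h3

theorem tendsto_affine (D a : ℕ) (hD : 2 ≤ D) : Tendsto (fun m => D * m + a) atTop atTop := by
  apply tendsto_atTop_mono (f := fun m => m) _ tendsto_id
  intro m
  nlinarith

theorem good_X0 : Good X0 where
  restr := fun D a hD w hw => Filter.Tendsto.comp (g := w) hw (tendsto_affine D a hD)
  glue := fun D hD w hw => tendsto_glue D hD w hw
  base := fun d p h hP z hz => by
    refine base_gen h e0 e0_inj mem_X0 hP ?_ z hz
    intro x y hxy
    refine c0_norm_le _ _ (norm_nonneg _) fun n => ?_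
    have : y n = Sop d p (e0 x) n := congrFun hxy n
    rw [this]
    refine (h.Sop_norm_le _ n).trans ?_
    calc ∑ m ∈ range (n + 2), s d p n m * ‖x m‖
        ≤ ∑ m ∈ range (n + 2), s d p n m * ‖x‖ :=
          Finset.sum_le_sum fun m _ => mul_le_mul_of_nonneg_left (c0_apply_le x m) (h.s_nonneg _ _)
      _ = ‖x‖ := by rw [← Finset.sum_mul, h.row_sum n _ le_rfl, one_mul]

/-! weak nullity in c0 -/

/-- unit vectors -/
def u0 (n : ℕ) : C₀(ℕ, ℂ) := mk0 (fun k => if k = n then 1 else 0) (by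
  apply tendsto_const_nhds.congr'
  filter_upwards [eventually_gt_atTop n] with k hk
  rw [if_neg (by omega)])

theorem sum_u0_apply (F : Finset ℕ) (c : ℕ → ℂ) (k : ℕ) :
    (∑ n ∈ F, c n • u0 n) k = if k ∈ F then c k else 0 := by
  have : (∑ n ∈ F, c n • u0 n) k = ∑ n ∈ F, (c n • u0 n) k := by
    have := congrFun (map_sum e0 (fun n => c n • u0 n) F) k
    rw [Finset.sum_apply] at this
    exact this
  rw [this]
  have h2 : ∀ n, (c n • u0 n) k = if k = n then c n else 0 := by
    intro n
    show c n * (if k = n then 1 else 0) = _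
    split_ifs <;> simp
  simp only [h2]
  simp

theorem sum_phi_le (φ : C₀(ℕ, ℂ) →L[ℂ] ℂ) (F : Finset ℕ) : ∑ n ∈ F, ‖φ (u0 n)‖ ≤ ‖φ‖ := by
  let c : ℕ → ℂ := fun n => (starRingEnd ℂ) (φ (u0 n)) / ‖φ (u0 n)‖
  have hc : ∀ n, ‖c n‖ ≤ 1 := by
    intro n
    simp only [c, norm_div, RCLike.norm_conj, Complex.norm_real, norm_norm]
    exact div_self_le_one _
  have hcφ : ∀ n, c n * φ (u0 n) = (‖φ (u0 n)‖ : ℂ) := by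
    intro n
    by_cases h0 : φ (u0 n) = 0
    · simp [c, h0]
    · have : (‖φ (u0 n)‖ : ℂ) ≠ 0 := by simpa using h0
      simp only [c]
      rw [div_mul_eq_mul_div, div_eq_iff this, mul_comm, Complex.mul_conj, Complex.normSq_eq_norm_sq]
      push_cast; ring
  have h1 : ‖∑ n ∈ F, c n • u0 n‖ ≤ 1 := by
    refine c0_norm_le _ _ zero_le_one fun k => ?_
    rw [sum_u0_apply]
    split_ifs
    · exact hc k
    · simp
  have h2 : φ (∑ n ∈ F, c n • u0 n) = ((∑ n ∈ F, ‖φ (u0 n)‖ : ℝ) : ℂ) := by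
    rw [map_sum]
    push_cast
    refine Finset.sum_congr rfl fun n _ => ?_
    rw [map_smul, smul_eq_mul, hcφ]
  have h3 := φ.le_opNorm (∑ n ∈ F, c n • u0 n)
  rw [h2, Complex.norm_real, Real.norm_of_nonneg (Finset.sum_nonneg fun _ _ => norm_nonneg _)] at h3
  nlinarith [norm_nonneg φ]

theorem hasSum_u0 (x : C₀(ℕ, ℂ)) : HasSum (fun n => x n • u0 n) x := by
  rw [HasSum, SummationFilter.unconditional_filter, Metric.tendsto_atTop]
  intro ε hε
  obtain ⟨N, hN⟩ := Metric.tendsto_atTop.1 (c0_tendsto x) (ε / 2) (by positivity)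
  refine ⟨range N, fun F hF => ?_⟩
  rw [dist_eq_norm]
  refine lt_of_le_of_lt (c0_norm_le _ (ε / 2) (by positivity) fun k => ?_) (by linarith)
  rw [ZeroAtInftyContinuousMap.sub_apply, sum_u0_apply]
  split_ifs with hk
  · simp; positivity
  · have h1 : N ≤ k := by
      by_contra hc
      exact hk (hF (Finset.mem_range.2 (by omega)))
    have := hN k h1
    rw [dist_zero_right] at this
    rw [zero_sub, norm_neg]
    exact this.le

theorem weak_null (φ : C₀(ℕ, ℂ) →L[ℂ] ℂ) (x : ℕ → C₀(ℕ, ℂ)) (C : ℝ) (hC : ∀ k n, ‖x k n‖ ≤ C)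
    (h0 : ∀ n, Tendsto (fun k => x k n) atTop (𝓝 0)) : Tendsto (fun k => φ (x k)) atTop (𝓝 0) := by
  have h1 : ∀ y : C₀(ℕ, ℂ), φ y = ∑' n, y n * φ (u0 n) := by
    intro y
    have := φ.hasSum (hasSum_u0 y)
    simp only [map_smul, smul_eq_mul] at this
    exact this.tsum_eq.symm
  rw [funext fun k => h1 (x k)]
  have hs : Summable fun n => C * ‖φ (u0 n)‖ :=
    (summable_of_sum_le (fun _ => norm_nonneg _) (sum_phi_le φ)).mul_left C
  have h2 := tendsto_tsum_of_dominated_convergence (𝓕 := atTop) (f := fun k n => x k n * φ (u0 n))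
    (g := fun _ => (0 : ℂ)) hs (fun n => by
      have := (h0 n).mul_const (φ (u0 n))
      rwa [zero_mul] at this)
    (Filter.Eventually.of_forall fun k n => by
      rw [norm_mul]
      exact mul_le_mul_of_nonneg_right (hC k n) (norm_nonneg _))
  simpa using h2

theorem Mach.wk_tendsto {d : ℕ → ℕ} {p : ℕ → ℝ} (h : Mach d p) (k : ℕ) (z : ℂ) :
    Tendsto (wk k d p z) atTop (𝓝 0) := by
  obtain ⟨N, hN⟩ := h.wk_supp k z
  apply tendsto_const_nhds.congr'
  filter_upwards [eventually_ge_atTop N] with n hn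
  rw [hN n hn]

theorem Mach.spec_c0 {d : ℕ → ℕ} {p : ℕ → ℝ} (h : Mach d p)
    {M : Type*} [NormedAddCommGroup M] [NormedSpace ℂ M]
    (T0 : C₀(ℕ, ℂ) →L[ℂ] C₀(ℕ, ℂ)) (hT0 : ∀ w n, T0 w n = Sop d p w n)
    (T : M →L[ℂ] M) (J : C₀(ℕ, ℂ) →L[ℂ] M) (ev : M →L[ℂ] ℂ)
    (hJ : ∀ x, T (J x) = J (T0 x)) (hev : ∀ x, ev (J x) = x 0) (z : ℂ) (hz : z ∈ E d p) :
    z ∈ spectrum ℂ T := by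
  by_contra hc
  rw [spectrum.notMem_iff] at hc
  obtain ⟨u, hu⟩ := hc
  obtain ⟨C, hC⟩ := E_iff d p z hz
  let φ : C₀(ℕ, ℂ) →L[ℂ] ℂ := ev.comp ((u⁻¹).val.comp J)
  let W : ℕ → C₀(ℕ, ℂ) := fun k => mk0 (wk k d p z) (h.wk_tendsto k z)
  have hres : ∀ k n, (z • W k - T0 (W k)) n = - res k d p z n := by
    intro k n
    rw [ZeroAtInftyContinuousMap.sub_apply, hT0, res]
    show z * wk k d p z n - _ = _
    rw [neg_sub]
    rfl
  have h1 := weak_null φ (fun k => z • W k - T0 (W k)) (1 + C) (fun k n => by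
      rw [hres, norm_neg]
      exact (h.res_le k n z).trans (by linarith [hC k]))
    (fun n => by
      apply tendsto_const_nhds.congr'
      filter_upwards [eventually_gt_atTop n] with k hk
      rw [hres, h.res_eq_zero k n z hk, neg_zero])
  have h2 : ∀ k, φ (z • W k - T0 (W k)) = 1 := by
    intro k
    have e1 : J (z • W k - T0 (W k)) = u.val (J (W k)) := by
      rw [hu, map_sub, map_smul, ← hJ, Algebra.algebraMap_eq_smul_one]
      rfl
    have e2 : (u⁻¹).val (u.val (J (W k))) = J (W k) := by
      show ((u⁻¹).val * u.val) (J (W k)) = _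
      rw [Units.inv_mul]; rfl
    show ev ((u⁻¹).val (J (z • W k - T0 (W k)))) = 1
    rw [e1, e2, hev]
    exact wk_zero k d p z
  simp only [h2] at h1
  exact one_ne_zero (tendsto_nhds_unique tendsto_const_nhds h1)

/-! lp -/

section lpspace
variable (α : ℝ≥0∞) [Fact (1 ≤ α)]

/-- the sequence space -/
def Xp : Submodule ℂ (ℕ → ℂ) where
  carrier := {w | Memℓp w α}
  add_mem' := fun ha hb => ha.add hb
  zero_mem' := zero_memℓp
  smul_mem' := fun c _ hw => hw.const_smul c

/-- coercion as a linear map -/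
def ep : lp (fun _ : ℕ => ℂ) α →ₗ[ℂ] (ℕ → ℂ) where
  toFun := fun x => ⇑x
  map_add' := fun _ _ => rfl
  map_smul' := fun _ _ => rfl

theorem ep_inj : Function.Injective (ep α) := fun _ _ h => lp.ext h

theorem mem_Xp (w : ℕ → ℂ) : w ∈ Xp α ↔ ∃ x, ep α x = w :=
  ⟨fun h => ⟨⟨w, h⟩, rfl⟩, by rintro ⟨x, rfl⟩; exact lp.memℓp x⟩

theorem one_le_toReal (hα : α ≠ ⊤) : 1 ≤ α.toReal := by
  have := ENNReal.toReal_mono hα (Fact.out : 1 ≤ α)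
  simpa using this

theorem Mach.schur {d : ℕ → ℕ} {p : ℕ → ℝ} (h : Mach d p) (r : ℝ) (hr : 1 ≤ r) (w : ℕ → ℂ) (N : ℕ) :
    ∑ n ∈ range N, ‖Sop d p w n‖ ^ r ≤ ∑ m ∈ range (N + 1), ‖w m‖ ^ r := by
  have h1 : ∀ n ∈ range N, ‖Sop d p w n‖ ^ r ≤ ∑ m ∈ range (N + 1), s d p n m * ‖w m‖ ^ r := by
    intro n hn
    have hn' : n + 2 ≤ N + 1 := by simp at hn; omega
    have h2 : ‖Sop d p w n‖ ≤ ∑ m ∈ range (N + 1), s d p n m * ‖w m‖ := by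
      rw [h.Sop_eq w n _ hn']
      refine (norm_sum_le _ _).trans (le_of_eq (Finset.sum_congr rfl fun m _ => ?_))
      rw [norm_mul, Complex.norm_real, Real.norm_of_nonneg (h.s_nonneg _ _)]
    refine (Real.rpow_le_rpow (norm_nonneg _) h2 (by linarith)).trans ?_
    exact Real.rpow_arith_mean_le_arith_mean_rpow _ _ _ (fun m _ => h.s_nonneg _ _)
      (h.row_sum n _ hn') (fun m _ => norm_nonneg _) hr
  refine (Finset.sum_le_sum h1).trans ?_
  rw [Finset.sum_comm]
  refine Finset.sum_le_sum fun m _ => ?_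
  rw [← Finset.sum_mul]
  exact mul_le_of_le_one_left (by positivity) (h.col_sum N m)

theorem subset_range (F : Finset ℕ) : ∃ N, F ⊆ range N :=
  ⟨F.sup id + 1, fun n hn => Finset.mem_range.2 (Nat.lt_succ_of_le (Finset.le_sup (f := id) hn))⟩

theorem good_Xp (hα : α ≠ ⊤) : Good (Xp α) where
  restr := fun D a hD w hw => by
    have hr := one_le_toReal α hα
    have h1 : Summable fun n => ‖w n‖ ^ α.toReal := Memℓp.summable (by linarith) hw
    refine memℓp_gen (h1.comp_injective (i := fun m => D * m + a) ?_)
    intro x y hxy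
    simp only [add_left_inj] at hxy
    exact Nat.eq_of_mul_eq_mul_left (by omega) hxy
  glue := fun D hD w hw => by
    have hr := one_le_toReal α hα
    have h1 : ∀ a < D, Summable fun m => ‖w (D * m + a)‖ ^ α.toReal :=
      fun a ha => Memℓp.summable (by linarith) (hw a ha)
    refine memℓp_gen' (C := ∑ a ∈ range D, ∑' m, ‖w (D * m + a)‖ ^ α.toReal) fun F => ?_
    have e : ∑ i ∈ F, ‖w i‖ ^ α.toReal = ∑ a ∈ range D, ∑ i ∈ F with i % D = a, ‖w i‖ ^ α.toReal :=
      (Finset.sum_fiberwise_of_maps_to (fun i _ => Finset.mem_range.2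
        (Nat.mod_lt i (by omega : 0 < D))) _).symm
    rw [e]
    refine Finset.sum_le_sum fun a ha => ?_
    have hk : ∀ i ∈ F.filter (fun i => i % D = a), D * (i / D) + a = i := by
      intro i hi
      have := Nat.div_add_mod i D
      simp at hi
      rwa [hi.2] at this
    have e2 : ∑ i ∈ F with i % D = a, ‖w i‖ ^ α.toReal =
        ∑ m ∈ (F.filter (fun i => i % D = a)).image (fun i => i / D),
          ‖w (D * m + a)‖ ^ α.toReal := by
      rw [Finset.sum_image]
      · exact Finset.sum_congr rfl fun i hi => by rw [hk i hi]
      · intro x hx y hy hxy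
        simp only at hxy
        rw [← hk x hx, ← hk y hy, hxy]
    rw [e2]
    exact (h1 a (Finset.mem_range.1 ha)).sum_le_tsum _ (fun _ _ => by positivity)
  base := fun d p h hP z hz => by
    have hr := one_le_toReal α hα
    refine base_gen h (ep α) (ep_inj α) (mem_Xp α) hP ?_ z hz
    intro x y hxy
    refine lp.norm_le_of_forall_sum_le (by linarith) (norm_nonneg _) fun F => ?_
    obtain ⟨N, hN⟩ := subset_range F
    calc ∑ i ∈ F, ‖y i‖ ^ α.toReal ≤ ∑ i ∈ range N, ‖y i‖ ^ α.toReal :=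
          Finset.sum_le_sum_of_subset_of_nonneg hN fun _ _ _ => by positivity
      _ = ∑ i ∈ range N, ‖Sop d p (ep α x) i‖ ^ α.toReal := by rw [← hxy]; rfl
      _ ≤ ∑ m ∈ range (N + 1), ‖x m‖ ^ α.toReal := h.schur _ hr _ N
      _ ≤ ‖x‖ ^ α.toReal := lp.sum_rpow_le_norm_rpow (by linarith) x _

theorem Mach.spec_lp (hα : α ≠ ⊤) {d : ℕ → ℕ} {p : ℕ → ℝ} (h : Mach d p)
    (T : lp (fun _ : ℕ => ℂ) α →L[ℂ] lp (fun _ : ℕ => ℂ) α) (hT : ∀ w n, T w n = Sop d p w n)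
    (z : ℂ) (hz : z ∈ E d p) : z ∈ spectrum ℂ T := by
  by_contra hc
  rw [spectrum.notMem_iff] at hc
  obtain ⟨u, hu⟩ := hc
  obtain ⟨C, hC⟩ := E_iff d p z hz
  have hr := one_le_toReal α hα
  have hC0 : 0 ≤ C := (norm_nonneg _).trans (hC 0)
  have hinv : ∀ x, (u⁻¹).val (u.val x) = x := by
    intro x
    show ((u⁻¹).val * u.val) x = _
    rw [Units.inv_mul]; rfl
  have huap : ∀ x n, (u.val x : ℕ → ℂ) n = z * x n - Sop d p x n := by
    intro x n
    rw [hu, Algebra.algebraMap_eq_smul_one, ← hT]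
    rfl
  have hmem : ∀ k, Memℓp (wk k d p z) α := by
    intro k
    obtain ⟨N, hN⟩ := h.wk_supp k z
    refine Memℓp.of_exponent_ge (q := 0) (memℓp_zero ?_) (zero_le)
    refine (Set.finite_lt_nat N).subset fun n hn => ?_
    by_contra hh
    exact hn (hN n (by simpa using hh))
  let W : ℕ → lp (fun _ : ℕ => ℂ) α := fun k => ⟨wk k d p z, hmem k⟩
  have hres : ∀ k n, (u.val (W k) : ℕ → ℂ) n = - res k d p z n := by
    intro k n
    rw [huap, res, neg_sub]
  have hn : ∀ k, ‖u.val (W k)‖ ≤ 1 + C := by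
    intro k
    refine lp.norm_le_of_forall_sum_le (by linarith) (by linarith) fun F => ?_
    obtain ⟨N, hN⟩ := subset_range F
    have hB : (0 : ℝ) < 1 + C := by linarith
    calc ∑ i ∈ F, ‖(u.val (W k) : ℕ → ℂ) i‖ ^ α.toReal
        ≤ ∑ i ∈ range N, ‖(u.val (W k) : ℕ → ℂ) i‖ ^ α.toReal :=
          Finset.sum_le_sum_of_subset_of_nonneg hN fun _ _ _ => by positivity
      _ ≤ ∑ i ∈ range N, (1 + C) ^ (α.toReal - 1) * ‖res k d p z i‖ := by
          refine Finset.sum_le_sum fun i _ => ?_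
          rw [hres, norm_neg]
          have hle : ‖res k d p z i‖ ≤ 1 + C := (h.res_le k i z).trans (by linarith [hC k])
          rcases (norm_nonneg (res k d p z i)).eq_or_lt with h0 | h0
          · rw [← h0, Real.zero_rpow (by linarith)]; simp
          · have : ‖res k d p z i‖ ^ α.toReal =
                ‖res k d p z i‖ ^ (α.toReal - 1) * ‖res k d p z i‖ := by
              rw [Real.rpow_sub_one h0.ne']; field_simp
            rw [this]
            exact mul_le_mul_of_nonneg_right
              (Real.rpow_le_rpow h0.le hle (by linarith)) h0.le
      _ ≤ (1 + C) ^ (α.toReal - 1) * (1 + C) := by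
          rw [← Finset.mul_sum]
          refine mul_le_mul_of_nonneg_left ?_ (by positivity)
          exact (h.res_sum k N z).trans (by linarith [hC k])
      _ = (1 + C) ^ α.toReal := by
          rw [Real.rpow_sub_one hB.ne']; field_simp
  have hb : Bornology.IsBounded (Set.range W) := by
    rw [isBounded_iff_forall_norm_le]
    refine ⟨‖(u⁻¹).val‖ * (1 + C), ?_⟩
    rintro _ ⟨k, rfl⟩
    rw [← hinv (W k)]
    refine ((u⁻¹).val.le_opNorm _).trans ?_
    exact mul_le_mul_of_nonneg_left (hn k) (norm_nonneg _)
  have hv : Memℓp (fun n => wk n d p z n) α := by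
    refine lp.memℓp_of_tendsto (l := atTop) hb (tendsto_pi_nhds.2 fun n => ?_)
    apply tendsto_const_nhds.congr'
    filter_upwards [eventually_ge_atTop n] with k hk
    exact (h.wk_stable k n z hk).symm
  let v : lp (fun _ : ℕ => ℂ) α := ⟨fun n => wk n d p z n, hv⟩
  have h1 : u.val v = 0 := by
    refine lp.ext (funext fun n => ?_)
    rw [huap]
    have : Sop d p v n = z * wk n d p z n := h.eigen z n
    rw [this]
    exact sub_self _
  have h2 : v = 0 := by rw [← hinv v, h1, map_zero]
  have h3 : (v : ℕ → ℂ) 0 = 0 := by rw [h2]; rfl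
  have h4 : (v : ℕ → ℂ) 0 = 1 := wk_zero 0 d p z
  rw [h3] at h4
  exact zero_ne_one h4

end lpspace

/-! c -/

theorem c_ext (x y : C(OnePoint ℕ, ℂ)) (h : ∀ n : ℕ, x (n : OnePoint ℕ) = y (n : OnePoint ℕ)) :
    x = y := by
  apply DFunLike.coe_injective
  exact OnePoint.denseRange_coe.equalizer x.continuous y.continuous (funext h)

/-- embedding of null sequences in convergent sequences -/
def J0 : C₀(ℕ, ℂ) →L[ℂ] C(OnePoint ℕ, ℂ) :=
  LinearMap.mkContinuous
    { toFun := fun x => OnePoint.continuousMapMkNat (fun n => x n) 0 (c0_tendsto x)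
      map_add' := fun _ _ => c_ext _ _ fun _ => rfl
      map_smul' := fun _ _ => c_ext _ _ fun _ => rfl } 1 (fun x => by
      rw [one_mul]
      refine (ContinuousMap.norm_le _ (norm_nonneg _)).2 fun n => ?_
      induction n using OnePoint.rec with
      | infty => exact (norm_zero (E := ℂ)).trans_le (norm_nonneg _)
      | coe n => exact c0_apply_le x n)

theorem J0_coe (x : C₀(ℕ, ℂ)) (n : ℕ) : J0 x (n : OnePoint ℕ) = x n := rfl

theorem J0_infty (x : C₀(ℕ, ℂ)) : J0 x OnePoint.infty = 0 := rfl

theorem J0_inj (x : C₀(ℕ, ℂ)) (h : J0 x = 0) : x = 0 := by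
  ext n
  rw [← J0_coe, h]; rfl

theorem c_decomp (y : C(OnePoint ℕ, ℂ)) : ∃ x, y = J0 x + y OnePoint.infty • 1 := by
  have h1 : Tendsto (fun n : ℕ => y (n : OnePoint ℕ)) atTop (𝓝 (y OnePoint.infty)) := by
    have := OnePoint.continuousAt_infty'.1 (y.continuous.continuousAt (x := OnePoint.infty))
    rw [coclosedCompact_eq_cocompact, cocompact_eq_cofinite, Nat.cofinite_eq_atTop] at this
    exact this
  have h2 := h1.sub_const (y OnePoint.infty)
  rw [sub_self] at h2
  refine ⟨mk0 _ h2, c_ext _ _ fun n => ?_⟩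
  rw [ContinuousMap.add_apply, J0_coe, mk0_apply]
  simp

/-- for `Ω ∈ {c₀, c, l^α (1 ≤ α < ∞)}`, the spectrum of the
transition operator `S` on `Ω` equals `E`. -/
theorem stmt7 (d : ℕ → ℕ) (p : ℕ → ℝ)
    (hd0 : d 0 = 1) (hd : ∀ j, 1 ≤ j → 2 ≤ d j)
    (hp : ∀ j, 1 ≤ j → p j ∈ Set.Ioc (0 : ℝ) 1)
    (α : ℝ≥0∞) [Fact (1 ≤ α)] (hα : α ≠ ⊤)
    (T0 : C₀(ℕ, ℂ) →L[ℂ] C₀(ℕ, ℂ))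
    (hT0 : ∀ (w : C₀(ℕ, ℂ)) (n : ℕ), T0 w n = ∑' m : ℕ, (s d p n m : ℂ) * w m)
    (Tc : C(OnePoint ℕ, ℂ) →L[ℂ] C(OnePoint ℕ, ℂ))
    (hTc : ∀ (w : C(OnePoint ℕ, ℂ)) (n : ℕ),
      Tc w (n : OnePoint ℕ) = ∑' m : ℕ, (s d p n m : ℂ) * w (m : OnePoint ℕ))
    (Ta : lp (fun _ : ℕ => ℂ) α →L[ℂ] lp (fun _ : ℕ => ℂ) α)
    (hTa : ∀ (w : lp (fun _ : ℕ => ℂ) α) (n : ℕ),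
      Ta w n = ∑' m : ℕ, (s d p n m : ℂ) * w m) :
    spectrum ℂ T0 = E d p ∧ spectrum ℂ Tc = E d p ∧ spectrum ℂ Ta = E d p := by
  have h : Mach d p := ⟨hd0, hd, hp⟩
  have hT0' : ∀ w n, T0 w n = Sop d p w n := hT0
  have hTa' : ∀ w n, Ta w n = Sop d p w n := hTa
  have hJ : ∀ x, Tc (J0 x) = J0 (T0 x) := by
    intro x
    refine c_ext _ _ fun n => ?_
    rw [hTc, J0_coe, hT0]
    rfl
  have hTc1 : Tc 1 = 1 := by
    refine c_ext _ _ fun n => ?_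
    rw [hTc]
    exact h.Sop_one n
  have hP0 : Pres X0 d p := by
    intro w hw
    obtain ⟨x, rfl⟩ := (mem_X0 w).1 hw
    exact (mem_X0 _).2 ⟨T0 x, funext fun n => hT0 x n⟩
  have hPa : Pres (Xp α) d p := by
    intro w hw
    obtain ⟨x, rfl⟩ := (mem_Xp α w).1 hw
    exact (mem_Xp α _).2 ⟨Ta x, funext fun n => hTa x n⟩
  have hn0 : ∀ z, z ∉ E d p → z ∉ spectrum ℂ T0 := by
    intro z hz
    obtain ⟨k, hk⟩ := not_E d p z hz
    exact (solv_iff e0 e0_inj mem_X0 T0 (fun x => funext fun n => hT0 x n) z).1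
      (good_X0.solv k h hP0 z hk)
  refine ⟨Set.Subset.antisymm ?_ ?_, Set.Subset.antisymm ?_ ?_, Set.Subset.antisymm ?_ ?_⟩
  · intro z hz
    by_contra hc
    exact hn0 z hc hz
  · intro z hz
    exact h.spec_c0 T0 hT0' T0 (ContinuousLinearMap.id ℂ _)
      (LinearMap.mkContinuous
        { toFun := fun x : C₀(ℕ, ℂ) => x 0
          map_add' := fun _ _ => rfl
          map_smul' := fun _ _ => rfl } 1 (fun x => by
            rw [one_mul]; exact c0_apply_le x 0)) (fun _ => rfl) (fun _ => rfl) z hz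
  · intro z hz
    by_contra hc
    refine absurd hz ?_
    have h1 := hn0 z hc
    rw [not_spec_iff] at h1 ⊢
    have hz1 : 1 - z ≠ 0 := by
      intro hh
      rw [sub_eq_zero] at hh
      exact hc (hh ▸ h.one_mem_E)
    have key : ∀ x (L : ℂ), (Tc - z • (1 : C(OnePoint ℕ, ℂ) →L[ℂ] C(OnePoint ℕ, ℂ))) (J0 x + L • 1) =
        J0 ((T0 - z • (1 : C₀(ℕ, ℂ) →L[ℂ] C₀(ℕ, ℂ))) x) + (L * (1 - z)) • 1 := by
      intro x L
      have e1 : (Tc - z • (1 : C(OnePoint ℕ, ℂ) →L[ℂ] C(OnePoint ℕ, ℂ))) (J0 x + L • 1) =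
          Tc (J0 x + L • 1) - z • (J0 x + L • 1) := rfl
      have e2 : (T0 - z • (1 : C₀(ℕ, ℂ) →L[ℂ] C₀(ℕ, ℂ))) x = T0 x - z • x := rfl
      rw [e1, e2, map_add, map_smul, hTc1, hJ, map_sub, map_smul]
      module
    constructor
    · rw [injective_iff_map_eq_zero]
      intro y hy
      obtain ⟨x, hx⟩ := c_decomp y
      rw [hx, key] at hy
      have h2 := congrArg (fun g : C(OnePoint ℕ, ℂ) => g OnePoint.infty) hy
      simp only [ContinuousMap.add_apply, J0_infty, ContinuousMap.smul_apply,
        ContinuousMap.one_apply, ContinuousMap.zero_apply, zero_add, smul_eq_mul, mul_one] at h2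
      have h3 : y OnePoint.infty = 0 := (mul_eq_zero.1 h2).resolve_right hz1
      rw [h3, zero_mul, zero_smul, add_zero] at hy
      have h4 := J0_inj _ hy
      have h5 := (injective_iff_map_eq_zero _).1 h1.1 x h4
      rw [hx, h3, h5, map_zero, zero_smul, add_zero]
    · intro g
      obtain ⟨g0, hg⟩ := c_decomp g
      obtain ⟨x, hx⟩ := h1.2 g0
      refine ⟨J0 x + (g OnePoint.infty / (1 - z)) • 1, ?_⟩
      rw [key, hx, div_mul_cancel₀ _ hz1, ← hg]
  · intro z hz
    exact h.spec_c0 T0 hT0' Tc J0 (ContinuousMap.evalCLM ℂ ((0 : ℕ) : OnePoint ℕ)) hJ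
      (fun x => J0_coe x 0) z hz
  · intro z hz
    by_contra hc
    obtain ⟨k, hk⟩ := not_E d p z hc
    exact (solv_iff (ep α) (ep_inj α) (mem_Xp α) Ta (fun x => funext fun n => hTa x n) z).1
      ((good_Xp α hα).solv k h hPa z hk) hz
  · intro z hz
    exact h.spec_lp α hα Ta hTa' z hz

end AMFC
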